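/- Let G be a finitely generated metabelian group whose abelianization G/[G,G] is cyclic, generated by the image of an element a ∈ G. Then every element d ∈ [G,G] can be written as d = [a, e] for some e ∈ [G,G]; consequently, any two elements of G that normally generate G and have the same image in G/[G,G] are conjugate in G. -/

import Mathlib

theorem metab_aux {G : Type*} [Group G]
    (hmet : ∀ x ∈ commutator G, ∀ y ∈ commutator G, x * y = y * x)
    (a : G) (ha : ∀ x : Abelianization G, x ∈ Subgroup.zpowers (Abelianization.of a)) :
    ∀ d ∈ commutator G, ∃ e ∈ commutator G, d = a⁻¹ * e⁻¹ * a * e := by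
  have hN : (commutator G).Normal := inferInstance
  have hu : ∀ e ∈ commutator G, a⁻¹ * e⁻¹ * a ∈ commutator G := fun e he => by
    simpa using hN.conj_mem _ (inv_mem he) a⁻¹
  let H : Subgroup G :=
    { carrier := {d | ∃ e ∈ commutator G, d = a⁻¹ * e⁻¹ * a * e}
      one_mem' := ⟨1, one_mem _, by simp⟩
      mul_mem' := by
        rintro _ _ ⟨e, he, rfl⟩ ⟨f, hf, rfl⟩
        refine ⟨f * e, mul_mem hf he, ?_⟩
        have h1 := hmet e he _ (hu f hf)
        calc a⁻¹ * e⁻¹ * a * e * (a⁻¹ * f⁻¹ * a * f)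
            = a⁻¹ * e⁻¹ * a * (e * (a⁻¹ * f⁻¹ * a)) * f := by group
          _ = a⁻¹ * e⁻¹ * f⁻¹ * a * (e * f) := by rw [h1]; group
          _ = _ := by rw [hmet e he f hf]; group
      inv_mem' := by
        rintro _ ⟨e, he, rfl⟩
        refine ⟨e⁻¹, inv_mem he, ?_⟩
        have h1 := hmet _ (inv_mem he) _ (inv_mem (hu e he))
        calc (a⁻¹ * e⁻¹ * a * e)⁻¹ = e⁻¹ * (a⁻¹ * e⁻¹ * a)⁻¹ := by group
          _ = _ := by rw [h1]; group }
  have hHN : H.Normal := by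
    constructor
    rintro _ ⟨e, he, rfl⟩ g
    have hf := hN.conj_mem e he g
    refine ⟨g * e * g⁻¹, hf, ?_⟩
    have hk : a⁻¹ * g * a * g⁻¹ ∈ commutator G := by
      have := Subgroup.commutator_mem_commutator (Subgroup.mem_top a⁻¹) (Subgroup.mem_top g)
      simpa [commutatorElement_def, commutator_def] using this
    have h1 := hmet _ hk _ (hu _ hf)
    generalize hkk : a⁻¹ * g * a * g⁻¹ = k at h1 hk
    have hg : g * a * g⁻¹ = a * k := by rw [← hkk]; group
    calc g * (a⁻¹ * e⁻¹ * a * e) * g⁻¹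
        = (g * a * g⁻¹)⁻¹ * (g * e * g⁻¹)⁻¹ * (g * a * g⁻¹) * (g * e * g⁻¹) := by group
      _ = k⁻¹ * ((a⁻¹ * (g * e * g⁻¹)⁻¹ * a) * k) * (g * e * g⁻¹) := by rw [hg]; group
      _ = _ := by rw [← h1]; group
  have hdec : ∀ x : G, ∃ n : ℤ, ∃ c ∈ commutator G, x = a ^ n * c := by
    intro x
    obtain ⟨n, hn⟩ := Subgroup.mem_zpowers_iff.1 (ha (Abelianization.of x))
    refine ⟨n, (a ^ n)⁻¹ * x, ?_, by group⟩
    rw [← Abelianization.ker_of, MonoidHom.mem_ker]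
    simp [← hn]
  have hac : ∀ c ∈ commutator G, Commute (a : G ⧸ H) (c : G ⧸ H) := by
    intro c hc
    have h1 : (((c * a)⁻¹ * (a * c) : G)) ∈ H := ⟨c, hc, by group⟩
    exact (QuotientGroup.eq.2 h1).symm
  have hle : commutator G ≤ H := by
    rw [commutator_def, Subgroup.commutator_le]
    intro x _ y _
    obtain ⟨n, c, hc, rfl⟩ := hdec x
    obtain ⟨m, d, hd, rfl⟩ := hdec y
    have hcd : Commute (c : G ⧸ H) (d : G ⧸ H) :=
      congrArg (QuotientGroup.mk (s := H)) (hmet c hc d hd)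
    have hA : Commute ((a : G ⧸ H) ^ n * c) ((a : G ⧸ H) ^ m * d) := by
      refine Commute.mul_left (Commute.mul_right ?_ ?_) (Commute.mul_right ?_ hcd)
      · exact (Commute.refl _).zpow_zpow n m
      · exact (hac d hd).zpow_left n
      · exact ((hac c hc).zpow_left m).symm
    rw [← QuotientGroup.eq_one_iff]
    exact commutatorElement_eq_one_iff_commute.2 hA
  exact fun d hd => hle hd

/-- let `G` be a finitely generated metabelian group (the commutator subgroup
is abelian) whose abelianization is cyclic, generated by the image of `a ∈ G`. Then every
`d ∈ [G,G]` equals `[a, e] = a⁻¹ * e⁻¹ * a * e` for some `e ∈ [G,G]`; consequently any two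
normal generators of `G` with the same image in the abelianization are conjugate. -/
theorem metabelian_cyclic_abelianization_weight_elements_conj
    {G : Type*} [Group G] [Group.FG G]
    (hmet : ∀ x ∈ commutator G, ∀ y ∈ commutator G, x * y = y * x)
    (a : G) (ha : ∀ x : Abelianization G, x ∈ Subgroup.zpowers (Abelianization.of a)) :
    (∀ d ∈ commutator G, ∃ e ∈ commutator G, d = a⁻¹ * e⁻¹ * a * e) ∧
    (∀ g h : G, Subgroup.normalClosure {g} = ⊤ → Subgroup.normalClosure {h} = ⊤ →
      Abelianization.of g = Abelianization.of h → IsConj g h) := by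
  refine ⟨metab_aux hmet a ha, fun g h hg _ hgh => ?_⟩
  have hgen : ∀ x : Abelianization G, x ∈ Subgroup.zpowers (Abelianization.of g) := by
    have hle : Subgroup.normalClosure {g} ≤
        (Subgroup.zpowers (Abelianization.of g)).comap Abelianization.of := by
      apply Subgroup.normalClosure_le_normal
      simp
    intro x
    obtain ⟨y, rfl⟩ := QuotientGroup.mk_surjective x
    exact hle (hg ▸ Subgroup.mem_top y)
  have hd : g⁻¹ * h ∈ commutator G := by
    rw [← Abelianization.ker_of, MonoidHom.mem_ker]
    simp [hgh]
  obtain ⟨e, _, he⟩ := metab_aux hmet g hgen _ hd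
  rw [isConj_iff]
  refine ⟨e⁻¹, ?_⟩
  calc e⁻¹ * g * e⁻¹⁻¹ = g * (g⁻¹ * e⁻¹ * g * e) := by group
    _ = h := by rw [← he]; group
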